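/- arXiv:1203.1422 — 2 statements merged into one kernel-verified Lean document; each statement's English description precedes it below -/
import Mathlib

section
/- Let a < b be reals, d a positive integer, 0 < α ≤ 1, A ∈ ℝ^d, and F : ℝ^d × [a,b] → ℝ^d continuous and K-Lipschitz in its first variable uniformly in t (K ≥ 0). Define the map φ on continuous functions g : [a,b] → ℝ^d by φ(g)(t) := A + I^α_-(s ↦ F(g(s),s))(t). Then for every n ≥ 1 and all continuous g₁, g₂ : [a,b] → ℝ^d, the n-fold iterate satisfies ‖φⁿ(g₁)(t) - φⁿ(g₂)(t)‖ ≤ (Kⁿ (t-a)^{nα} / Γ(1 + nα)) · ‖g₁ - g₂‖_∞ for every t ∈ [a,b], where ‖·‖_∞ is the supremum norm on [a,b]. -/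
open Set Filter Topology MeasureTheory RealInnerProductSpace

/-- Left Riemann–Liouville fractional integral of order `α` with inferior limit `a`.
(At `t = a` the integral vanishes, so `Ileft a α g a = 0`.) -/
noncomputable def Ileft {E : Type*} [NormedAddCommGroup E] [NormedSpace ℝ E]
    (a α : ℝ) (g : ℝ → E) (t : ℝ) : E :=
  (Real.Gamma α)⁻¹ • ∫ y in a..t, (t - y) ^ (α - 1) • g y

/-- Right Riemann–Liouville fractional integral of order `α` with superior limit `b`.
(At `t = b` the integral vanishes, so `Iright b α g b = 0`.) -/
noncomputable def Iright {E : Type*} [NormedAddCommGroup E] [NormedSpace ℝ E]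
    (b α : ℝ) (g : ℝ → E) (t : ℝ) : E :=
  (Real.Gamma α)⁻¹ • ∫ y in t..b, (y - t) ^ (α - 1) • g y

/-- The Picard-type operator `φ(g)(t) = A + I^α_-(s ↦ F(g(s),s))(t)`. -/
noncomputable def picardMap {E : Type*} [NormedAddCommGroup E] [NormedSpace ℝ E]
    (a α : ℝ) (A : E) (F : E → ℝ → E) (g : ℝ → E) : ℝ → E :=
  fun t => A + Ileft a α (fun s => F (g s) s) t

/-- The kernel `y ↦ (t - y) ^ (α - 1)` is integrable on `[a, t]` when `0 < α`. -/
lemma intervalIntegrable_sub_rpow {α : ℝ} (hα : 0 < α) (a t : ℝ) :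
    IntervalIntegrable (fun y : ℝ => (t - y) ^ (α - 1)) volume a t := by
  have h : IntervalIntegrable (fun y : ℝ => y ^ (α - 1)) volume (t - a) (t - t) :=
    intervalIntegral.intervalIntegrable_rpow' (by linarith)
  simpa using h.comp_sub_left t

/-- The Riemann–Liouville integrand of a continuous function is integrable. -/
lemma intervalIntegrable_sub_rpow_smul {E : Type*} [NormedAddCommGroup E] [NormedSpace ℝ E]
    {α a t : ℝ} (hα : 0 < α) (hat : a ≤ t) {g : ℝ → E} (hg : ContinuousOn g (Icc a t)) :
    IntervalIntegrable (fun y : ℝ => (t - y) ^ (α - 1) • g y) volume a t :=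
  (intervalIntegrable_sub_rpow hα a t).smul_continuousOn (by rwa [uIcc_of_le hat])

/-- The beta integral on `[0, T]` over the reals. -/
lemma integral_sub_rpow_mul_rpow {α β T : ℝ} (hα : 0 < α) (hβ : 0 ≤ β) (hT : 0 < T) :
    ∫ x in (0 : ℝ)..T, (T - x) ^ (α - 1) * x ^ β =
      T ^ (α + β) * (Real.Gamma α * Real.Gamma (1 + β) / Real.Gamma (1 + (α + β))) := by
  have hs : 0 < 1 + β := by linarith
  have key := Complex.betaIntegral_scaled ((1 + β : ℝ) : ℂ) (α : ℂ) hT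
  rw [Complex.betaIntegral_eq_Gamma_mul_div _ _ (by simpa using hs) (by simpa using hα)] at key
  have hL : (∫ x in (0 : ℝ)..T, (x : ℂ) ^ (((1 + β : ℝ) : ℂ) - 1) * ((T : ℂ) - x) ^ ((α : ℂ) - 1))
      = ((∫ x in (0 : ℝ)..T, (T - x) ^ (α - 1) * x ^ β : ℝ) : ℂ) := by
    rw [← intervalIntegral.integral_ofReal]
    refine intervalIntegral.integral_congr fun x hx => ?_
    rw [uIcc_of_le hT.le] at hx
    have h1 : (((1 + β : ℝ) : ℂ) - 1) = (β : ℂ) := by push_cast; ring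
    simp only [h1]
    rw [Complex.ofReal_mul, Complex.ofReal_cpow (sub_nonneg.2 hx.2), Complex.ofReal_cpow hx.1]
    push_cast
    ring
  rw [hL] at key
  have h2 : ((1 + β : ℝ) : ℂ) + (α : ℂ) - 1 = ((α + β : ℝ) : ℂ) := by push_cast; ring
  have h3 : ((1 + β : ℝ) : ℂ) + (α : ℂ) = ((1 + (α + β) : ℝ) : ℂ) := by push_cast; ring
  rw [h2, h3, Complex.Gamma_ofReal, Complex.Gamma_ofReal, Complex.Gamma_ofReal,
    ← Complex.ofReal_cpow hT.le] at key
  have key' : (∫ x in (0 : ℝ)..T, (T - x) ^ (α - 1) * x ^ β) = T ^ (α + β) *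
      (Real.Gamma (1 + β) * Real.Gamma α / Real.Gamma (1 + (α + β))) := by
    exact_mod_cast key
  rw [key', mul_comm (Real.Gamma α)]

/-- The Riemann–Liouville integral of a power of `y - a`. -/
lemma Ileft_sub_rpow {α β a t : ℝ} (hα : 0 < α) (hβ : 0 ≤ β) (hat : a ≤ t) :
    Ileft a α (fun y => (y - a) ^ β) t =
      Real.Gamma (1 + β) / Real.Gamma (1 + (α + β)) * (t - a) ^ (α + β) := by
  rcases hat.eq_or_lt with rfl | hlt
  · simp [Ileft, Real.zero_rpow (by linarith : α + β ≠ 0)]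
  · have h := intervalIntegral.integral_comp_sub_right (a := a) (b := t)
      (fun x => (t - a - x) ^ (α - 1) * x ^ β) a
    simp only [sub_sub_sub_cancel_right, sub_self] at h
    have hΓ := (Real.Gamma_pos_of_pos hα).ne'
    simp only [Ileft, smul_eq_mul]
    rw [h, integral_sub_rpow_mul_rpow hα hβ (sub_pos.2 hlt)]
    field_simp

/-- The Riemann–Liouville integral after the substitution `y = a + (t - a) s`. -/
lemma Ileft_eq_integral_unit {E : Type*} [NormedAddCommGroup E] [NormedSpace ℝ E]
    {α a t : ℝ} (hα : 0 < α) (hat : a ≤ t) (g : ℝ → E) :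
    Ileft a α g t = (Real.Gamma α)⁻¹ •
      (t - a) ^ α • ∫ s in (0 : ℝ)..1, (1 - s) ^ (α - 1) • g (a + (t - a) * s) := by
  rcases hat.eq_or_lt with rfl | hlt
  · simp [Ileft, Real.zero_rpow hα.ne']
  · have hT := sub_pos.2 hlt
    have h := intervalIntegral.smul_integral_comp_add_mul (a := 0) (b := 1)
      (fun y => (t - y) ^ (α - 1) • g y) (t - a) a
    simp only [mul_zero, add_zero, mul_one, add_sub_cancel] at h
    rw [Ileft, ← h]
    congr 1
    have hpow : (t - a) ^ α = (t - a) * (t - a) ^ (α - 1) := by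
      rw [Real.rpow_sub_one hT.ne']; field_simp
    rw [hpow, mul_smul, ← intervalIntegral.integral_smul ((t - a) ^ (α - 1))]
    congr 1
    refine intervalIntegral.integral_congr fun s hs => ?_
    rw [uIcc_of_le zero_le_one] at hs
    rw [smul_smul, ← Real.mul_rpow hT.le (sub_nonneg.2 hs.2)]
    congr 2
    ring

/-- The Riemann–Liouville integral of a continuous function is continuous. -/
lemma continuousOn_Ileft {E : Type*} [NormedAddCommGroup E] [NormedSpace ℝ E]
    {α a b : ℝ} (hα : 0 < α) (hab : a ≤ b) {g : ℝ → E} (hg : ContinuousOn g (Icc a b)) :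
    ContinuousOn (Ileft a α g) (Icc a b) := by
  set G : ℝ → E := IccExtend hab ((Icc a b).domRestrict g) with hG
  have hGc : Continuous G := hg.domRestrict.Icc_extend'
  obtain ⟨C, hC⟩ : ∃ C, ∀ y, ‖G y‖ ≤ C := by
    obtain ⟨C, hC⟩ := isCompact_Icc.exists_bound_of_continuousOn hg
    exact ⟨C, fun y => hC _ (projIcc a b hab y).2⟩
  have hcont : Continuous fun t : ℝ =>
      ∫ s in (0 : ℝ)..1, (1 - s) ^ (α - 1) • G (a + (t - a) * s) := by
    refine intervalIntegral.continuous_of_dominated_interval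
      (bound := fun s => (1 - s) ^ (α - 1) * C) (fun t => ?_) (fun t => ?_)
      ((intervalIntegrable_sub_rpow hα 0 1).mul_const C) ?_
    · exact ((intervalIntegrable_sub_rpow hα 0 1).smul_continuousOn
        (by fun_prop : Continuous fun s => G (a + (t - a) * s)).continuousOn).def'.1
    · refine ae_of_all _ fun s hs => ?_
      rw [uIoc_of_le zero_le_one] at hs
      have h0 : 0 ≤ (1 - s) ^ (α - 1) := Real.rpow_nonneg (sub_nonneg.2 hs.2) _
      rw [norm_smul, Real.norm_of_nonneg h0]
      exact mul_le_mul_of_nonneg_left (hC _) h0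
    · exact ae_of_all _ fun s _ => by fun_prop
  have hpow : Continuous fun t : ℝ => (t - a) ^ α :=
    (continuous_id.sub continuous_const).rpow_const fun _ => Or.inr hα.le
  refine ((hpow.smul hcont).const_smul (Real.Gamma α)⁻¹).continuousOn.congr fun t ht => ?_
  rw [Ileft_eq_integral_unit hα ht.1]
  congr 2
  refine intervalIntegral.integral_congr fun s hs => ?_
  rw [uIcc_of_le zero_le_one] at hs
  have hmem : a + (t - a) * s ∈ Icc a b := by
    have h1 : 0 ≤ t - a := sub_nonneg.2 ht.1
    constructor
    · nlinarith [mul_nonneg h1 hs.1]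
    · nlinarith [mul_le_mul_of_nonneg_left hs.2 h1, ht.2]
  simp only [hG, IccExtend_of_mem _ _ hmem, domRestrict_apply]

/-- If `‖f - g‖` is dominated by a multiple of `(y - a) ^ β`, then so is the difference of the
Riemann–Liouville integrals, with exponent `α + β`. -/
lemma norm_Ileft_sub_le {E : Type*} [NormedAddCommGroup E] [NormedSpace ℝ E]
    {α β a t C : ℝ} (hα : 0 < α) (hβ : 0 ≤ β) (hat : a ≤ t) {f g : ℝ → E}
    (hf : ContinuousOn f (Icc a t)) (hg : ContinuousOn g (Icc a t))
    (h : ∀ y ∈ Icc a t, ‖f y - g y‖ ≤ C * (y - a) ^ β) :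
    ‖Ileft a α f t - Ileft a α g t‖ ≤
      C * (Real.Gamma (1 + β) / Real.Gamma (1 + (α + β)) * (t - a) ^ (α + β)) := by
  have hΓ : 0 ≤ (Real.Gamma α)⁻¹ := (inv_pos.2 (Real.Gamma_pos_of_pos hα)).le
  have hpow : Continuous fun y : ℝ => (y - a) ^ β :=
    (continuous_id.sub continuous_const).rpow_const fun _ => Or.inr hβ
  have hint : IntervalIntegrable (fun y : ℝ => C * ((t - y) ^ (α - 1) • (y - a) ^ β))
      volume a t := (intervalIntegrable_sub_rpow_smul hα hat hpow.continuousOn).const_mul C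
  rw [← Ileft_sub_rpow hα hβ hat, Ileft, Ileft, Ileft, ← smul_sub,
    ← intervalIntegral.integral_sub (intervalIntegrable_sub_rpow_smul hα hat hf)
      (intervalIntegrable_sub_rpow_smul hα hat hg),
    norm_smul, Real.norm_of_nonneg hΓ, smul_eq_mul, mul_left_comm,
    ← intervalIntegral.integral_const_mul]
  refine mul_le_mul_of_nonneg_left ?_ hΓ
  refine intervalIntegral.norm_integral_le_of_norm_le hat (ae_of_all _ fun y hy => ?_) hint
  have h0 : 0 ≤ (t - y) ^ (α - 1) := Real.rpow_nonneg (sub_nonneg.2 hy.2) _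
  rw [← smul_sub, norm_smul, Real.norm_of_nonneg h0, smul_eq_mul, mul_left_comm]
  exact mul_le_mul_of_nonneg_left (h y ⟨hy.1.le, hy.2⟩) h0

/-- The integrand of the Picard operator is continuous along a continuous function. -/
lemma continuousOn_comp_graph {E : Type*} [TopologicalSpace E] {F : E → ℝ → E} {S : Set ℝ}
    (hF : ContinuousOn (fun p : E × ℝ => F p.1 p.2) (univ ×ˢ S))
    {g : ℝ → E} (hg : ContinuousOn g S) : ContinuousOn (fun s => F (g s) s) S :=
  hF.comp (hg.prodMk continuousOn_id) fun _ hs => ⟨mem_univ _, hs⟩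

/-- The iterates of the Picard operator preserve continuity. -/
lemma continuousOn_picardMap_iterate {E : Type*} [NormedAddCommGroup E] [NormedSpace ℝ E]
    {a b α : ℝ} (hα : 0 < α) (hab : a ≤ b) (A : E) {F : E → ℝ → E}
    (hF : ContinuousOn (fun p : E × ℝ => F p.1 p.2) (univ ×ˢ Icc a b))
    {g : ℝ → E} (hg : ContinuousOn g (Icc a b)) (n : ℕ) :
    ContinuousOn ((picardMap a α A F)^[n] g) (Icc a b) := by
  induction n with
  | zero => exact hg
  | succ n ih =>
    rw [Function.iterate_succ_apply']
    exact continuousOn_const.add (continuousOn_Ileft hα hab (continuousOn_comp_graph hF ih))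

/-- Contraction estimate for the iterates of the Picard operator associated to the
fractional Cauchy problem. -/
theorem picard_iterate_estimate
    (a b : ℝ) (hab : a < b) (d : ℕ) (hd : 0 < d) (α : ℝ) (hα0 : 0 < α) (hα1 : α ≤ 1)
    (A : EuclideanSpace ℝ (Fin d))
    (F : EuclideanSpace ℝ (Fin d) → ℝ → EuclideanSpace ℝ (Fin d))
    (hF : ContinuousOn (fun p : EuclideanSpace ℝ (Fin d) × ℝ => F p.1 p.2)
      (univ ×ˢ Icc a b))
    (K : ℝ) (hK : 0 ≤ K)
    (hlip : ∀ x₁ x₂ : EuclideanSpace ℝ (Fin d), ∀ t ∈ Icc a b,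
      ‖F x₁ t - F x₂ t‖ ≤ K * ‖x₁ - x₂‖) :
    ∀ n : ℕ, 1 ≤ n → ∀ g₁ g₂ : ℝ → EuclideanSpace ℝ (Fin d),
      ContinuousOn g₁ (Icc a b) → ContinuousOn g₂ (Icc a b) →
      ∀ t ∈ Icc a b,
        ‖(picardMap a α A F)^[n] g₁ t - (picardMap a α A F)^[n] g₂ t‖ ≤
          K ^ n * (t - a) ^ ((n : ℝ) * α) / Real.Gamma (1 + n * α) *
            sSup ((fun s => ‖g₁ s - g₂ s‖) '' Icc a b) := by
  rintro n - g₁ g₂ hg₁ hg₂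
  induction n with
  | zero =>
    intro t ht
    have hbdd : BddAbove ((fun s => ‖g₁ s - g₂ s‖) '' Icc a b) :=
      isCompact_Icc.bddAbove_image (hg₁.sub hg₂).norm
    simpa using le_csSup hbdd (mem_image_of_mem _ ht)
  | succ n ih =>
    intro t ht
    have hsub : Icc a t ⊆ Icc a b := Icc_subset_Icc_right ht.2
    have hβ : 0 ≤ (n : ℝ) * α := by positivity
    set S := sSup ((fun s => ‖g₁ s - g₂ s‖) '' Icc a b)
    have hcont : ∀ g : ℝ → EuclideanSpace ℝ (Fin d), ContinuousOn g (Icc a b) →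
        ContinuousOn (fun s => F ((picardMap a α A F)^[n] g s) s) (Icc a t) := fun g hg =>
      (continuousOn_comp_graph hF
        (continuousOn_picardMap_iterate hα0 hab.le A hF hg n)).mono hsub
    have key := norm_Ileft_sub_le (C := K ^ (n + 1) / Real.Gamma (1 + n * α) * S)
      hα0 hβ ht.1 (hcont g₁ hg₁) (hcont g₂ hg₂) fun y hy => by
        calc _ ≤ _ := hlip _ _ y (hsub hy)
          _ ≤ _ := mul_le_mul_of_nonneg_left (ih y (hsub hy)) hK
          _ = _ := by ring
    rw [Function.iterate_succ_apply', Function.iterate_succ_apply', picardMap, picardMap,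
      add_sub_add_left_eq_sub]
    refine key.trans_eq ?_
    have hexp : ((n + 1 : ℕ) : ℝ) * α = α + n * α := by push_cast; ring
    have hΓ : Real.Gamma (1 + n * α) ≠ 0 := (Real.Gamma_pos_of_pos (by linarith)).ne'
    rw [hexp]
    field_simp
end

section
/- Stability of order 1 for the fractional state equation: let a < b, d, m positive integers, 0 < α ≤ 1, A ∈ ℝ^d, and f : ℝ^d × ℝ^m × [a,b] → ℝ^d of class C¹ satisfying the Lipschitz condition ‖f(x₁,v,t) - f(x₂,v,t)‖ ≤ M ‖x₁ - x₂‖ for some M ≥ 0 and all x₁, x₂ ∈ ℝ^d, v ∈ ℝ^m, t ∈ [a,b]. Let u, ū : [a,b] → ℝ^m be continuous, and let Q : ℝ → ([a,b] → ℝ^d) be such that for every ε ∈ ℝ, Q(ε) is continuous and satisfies Q(ε)(t) = A + I^α_-(s ↦ f(Q(ε)(s), u(s) + ε ū(s), s))(t) for all t ∈ [a,b]. Then there exists a constant C₁ ≥ 0 such that for all ε with |ε| < 1 and all t ∈ [a,b], ‖Q(ε)(t) - Q(0)(t)‖ ≤ C₁ |ε|. -/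
open Set Filter Topology MeasureTheory RealInnerProductSpace

/-- The Abel kernel `y ↦ (t - y) ^ (α - 1)` is integrable up to its singularity. -/
theorem intervalIntegrable_abel_kernel {α : ℝ} (hα : 0 < α) (a t : ℝ) :
    IntervalIntegrable (fun y => (t - y) ^ (α - 1)) volume a t := by
  have h := (intervalIntegral.intervalIntegrable_rpow' (a := t - a) (b := 0)
    (r := α - 1) (by linarith)).comp_sub_left t
  simpa using h

theorem intervalIntegrable_abel_kernel_smul {E : Type*} [NormedAddCommGroup E] [NormedSpace ℝ E]
    {α a t : ℝ} (hα : 0 < α) (hat : a ≤ t) {g : ℝ → E} (hg : ContinuousOn g (Icc a t)) :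
    IntervalIntegrable (fun y => (t - y) ^ (α - 1) • g y) volume a t :=
  (intervalIntegrable_abel_kernel hα a t).smul_continuousOn (by rwa [uIcc_of_le hat])

/-- Comparison principle for the left fractional integral. -/
theorem norm_Ileft_sub_le_s12 {E : Type*} [NormedAddCommGroup E] [NormedSpace ℝ E]
    {α a t : ℝ} (hα : 0 < α) (hat : a ≤ t) {g₁ g₂ : ℝ → E} {h : ℝ → ℝ}
    (hg₁ : ContinuousOn g₁ (Icc a t)) (hg₂ : ContinuousOn g₂ (Icc a t))
    (hh : ContinuousOn h (Icc a t)) (hle : ∀ y ∈ Icc a t, ‖g₁ y - g₂ y‖ ≤ h y) :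
    ‖Ileft a α g₁ t - Ileft a α g₂ t‖ ≤ Ileft a α h t := by
  have hΓ : 0 ≤ (Real.Gamma α)⁻¹ := inv_nonneg.2 (Real.Gamma_pos_of_pos hα).le
  unfold Ileft
  rw [← smul_sub, norm_smul, Real.norm_of_nonneg hΓ, smul_eq_mul,
    ← intervalIntegral.integral_sub (intervalIntegrable_abel_kernel_smul hα hat hg₁)
      (intervalIntegrable_abel_kernel_smul hα hat hg₂)]
  refine mul_le_mul_of_nonneg_left ?_ hΓ
  refine intervalIntegral.norm_integral_le_of_norm_le hat (ae_of_all _ fun y hy => ?_)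
    (intervalIntegrable_abel_kernel_smul hα hat hh)
  have hk : 0 ≤ (t - y) ^ (α - 1) := Real.rpow_nonneg (sub_nonneg.2 hy.2) _
  rw [← smul_sub, norm_smul, Real.norm_of_nonneg hk, smul_eq_mul]
  exact mul_le_mul_of_nonneg_left (hle y (Ioc_subset_Icc_self hy)) hk

theorem Ileft_mono {α a t : ℝ} (hα : 0 < α) (hat : a ≤ t) {g h : ℝ → ℝ}
    (hg : ContinuousOn g (Icc a t)) (hh : ContinuousOn h (Icc a t))
    (hle : ∀ y ∈ Icc a t, g y ≤ h y) : Ileft a α g t ≤ Ileft a α h t := by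
  refine mul_le_mul_of_nonneg_left ?_ (inv_nonneg.2 (Real.Gamma_pos_of_pos hα).le)
  refine intervalIntegral.integral_mono_on hat (intervalIntegrable_abel_kernel_smul hα hat hg)
    (intervalIntegrable_abel_kernel_smul hα hat hh) fun y hy => ?_
  exact mul_le_mul_of_nonneg_left (hle y hy) (Real.rpow_nonneg (sub_nonneg.2 hy.2) _)

/-- The fractional integral of an exponential weight gains a factor `l ^ (-α)`. -/
theorem Ileft_exp_le {α a t l : ℝ} (hα : 0 < α) (hat : a ≤ t) (hl : 0 < l) :
    Ileft a α (fun y => Real.exp (l * (y - a))) t ≤ Real.exp (l * (t - a)) / l ^ α := by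
  have key := Real.integral_rpow_mul_exp_neg_mul_Ioi hα hl
  have hΓ := Real.Gamma_pos_of_pos hα
  have hint : IntegrableOn (fun s : ℝ => s ^ (α - 1) * Real.exp (-(l * s))) (Ioi 0) :=
    .of_integral_ne_zero (by rw [key]; positivity)
  have hsub : (∫ y in a..t, (t - y) ^ (α - 1) • Real.exp (l * (y - a)))
      = Real.exp (l * (t - a)) * ∫ s in (0 : ℝ)..(t - a), s ^ (α - 1) * Real.exp (-(l * s)) := by
    rw [← intervalIntegral.integral_const_mul]
    have h := intervalIntegral.integral_comp_sub_left (a := a) (b := t)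
      (fun s : ℝ => Real.exp (l * (t - a)) * (s ^ (α - 1) * Real.exp (-(l * s)))) t
    rw [sub_self] at h
    rw [← h]
    refine intervalIntegral.integral_congr fun y _ => ?_
    have : Real.exp (l * (y - a)) = Real.exp (l * (t - a)) * Real.exp (-(l * (t - y))) := by
      rw [← Real.exp_add]; ring_nf
    simp only [smul_eq_mul, this]
    ring
  have hle : (∫ s in (0 : ℝ)..(t - a), s ^ (α - 1) * Real.exp (-(l * s)))
      ≤ (1 / l) ^ α * Real.Gamma α := by
    rw [← key, intervalIntegral.integral_of_le (sub_nonneg.2 hat)]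
    refine setIntegral_mono_set hint ?_ Ioc_subset_Ioi_self.eventuallyLE
    refine (ae_restrict_iff' measurableSet_Ioi).2 (ae_of_all _ fun s hs => ?_)
    exact mul_nonneg (Real.rpow_nonneg (le_of_lt hs) _) (Real.exp_nonneg _)
  unfold Ileft
  rw [hsub, smul_eq_mul]
  calc (Real.Gamma α)⁻¹ * (Real.exp (l * (t - a)) *
        ∫ s in (0 : ℝ)..(t - a), s ^ (α - 1) * Real.exp (-(l * s)))
      ≤ (Real.Gamma α)⁻¹ * (Real.exp (l * (t - a)) * ((1 / l) ^ α * Real.Gamma α)) := by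
        gcongr
    _ = Real.exp (l * (t - a)) / l ^ α := by
        rw [one_div, Real.inv_rpow hl.le]
        field_simp

/-- A fractional Grönwall inequality, proved with an exponentially weighted supremum norm. -/
theorem le_mul_exp_of_le_Ileft {α a b M δ l : ℝ} (hα : 0 < α) (hM : 0 ≤ M)
    (hδ : 0 ≤ δ) (hl : 0 < l) (hlM : l ^ α = M + 1) {e : ℝ → ℝ} (he : ContinuousOn e (Icc a b))
    (he0 : ∀ t ∈ Icc a b, 0 ≤ e t)
    (hle : ∀ t ∈ Icc a b, e t ≤ Ileft a α (fun y => M * e y + δ) t) :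
    ∀ t ∈ Icc a b, e t ≤ δ * Real.exp (l * (t - a)) := by
  intro t₀ ht₀
  have hw : Continuous fun y => Real.exp (l * (y - a)) := by fun_prop
  obtain ⟨τ, hτ, hmax⟩ := isCompact_Icc.exists_isMaxOn ⟨t₀, ht₀⟩
    (he.div hw.continuousOn fun y _ => (Real.exp_pos _).ne')
  set N := e τ / Real.exp (l * (τ - a)) with hN
  have hN0 : 0 ≤ N := div_nonneg (he0 τ hτ) (Real.exp_nonneg _)
  have heN : ∀ y ∈ Icc a b, e y ≤ N * Real.exp (l * (y - a)) := fun y hy =>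
    (div_le_iff₀ (Real.exp_pos _)).1 (hmax hy)
  have hsub : Icc a τ ⊆ Icc a b := Icc_subset_Icc_right hτ.2
  have hstep : e τ ≤ (M * N + δ) * (Real.exp (l * (τ - a)) / l ^ α) := by
    calc e τ ≤ Ileft a α (fun y => M * e y + δ) τ := hle τ hτ
      _ ≤ Ileft a α (fun y => (M * N + δ) * Real.exp (l * (y - a))) τ := by
          refine Ileft_mono hα hτ.1 ?_ (by fun_prop) fun y hy => ?_
          · exact (continuousOn_const.mul (he.mono hsub)).add continuousOn_const
          · have h1 : 1 ≤ Real.exp (l * (y - a)) :=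
              Real.one_le_exp (mul_nonneg hl.le (sub_nonneg.2 hy.1))
            have h2 := mul_le_mul_of_nonneg_left (heN y (hsub hy)) hM
            have h3 := mul_le_mul_of_nonneg_left h1 hδ
            linarith
      _ = (M * N + δ) * Ileft a α (fun y => Real.exp (l * (y - a))) τ := by
          unfold Ileft
          simp only [smul_eq_mul, mul_left_comm _ (M * N + δ)]
          rw [intervalIntegral.integral_const_mul]
          ring
      _ ≤ _ := mul_le_mul_of_nonneg_left (Ileft_exp_le hα hτ.1 hl) (by positivity)
  have hNδ : N ≤ δ := by
    have h1 : N ≤ (M * N + δ) / (M + 1) := by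
      rw [hN, div_le_iff₀ (Real.exp_pos _), ← hN]
      rw [hlM] at hstep
      exact hstep.trans_eq (by ring)
    rw [le_div_iff₀ (by linarith)] at h1
    linarith
  exact (heN t₀ ht₀).trans (mul_le_mul_of_nonneg_right hNδ (Real.exp_nonneg _))

/-- A `C¹` map on a convex set is Lipschitz on compact convex subsets. -/
theorem ContDiffOn.exists_lipschitzOnWith_of_isCompact {E F : Type*}
    [NormedAddCommGroup E] [NormedSpace ℝ E] [NormedAddCommGroup F] [NormedSpace ℝ F]
    {f : E → F} {s : Set E} (hf : ContDiffOn ℝ 1 f s) (hs : IsCompact s) (hc : Convex ℝ s) :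
    ∃ K, LipschitzOnWith K f s :=
  LocallyLipschitzOn.exists_lipschitzOnWith_of_compact hs fun x hx =>
    (hf x hx).exists_lipschitzOnWith hc

/-- Stability of order 1 for the fractional state equation: the state variable associated to
the perturbed control `u + ε ū` stays at distance `O(|ε|)` from the unperturbed one. -/
theorem fractional_state_stability_order_one
    (a b : ℝ) (hab : a < b) (d m : ℕ) (hd : 0 < d) (hm : 0 < m)
    (α : ℝ) (hα0 : 0 < α) (hα1 : α ≤ 1)
    (A : EuclideanSpace ℝ (Fin d))
    (f : EuclideanSpace ℝ (Fin d) → EuclideanSpace ℝ (Fin m) → ℝ → EuclideanSpace ℝ (Fin d))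
    (hf : ContDiffOn ℝ 1
      (fun p : EuclideanSpace ℝ (Fin d) × EuclideanSpace ℝ (Fin m) × ℝ => f p.1 p.2.1 p.2.2)
      (univ ×ˢ univ ×ˢ Icc a b))
    (M : ℝ) (hM : 0 ≤ M)
    (hlip : ∀ x₁ x₂ : EuclideanSpace ℝ (Fin d), ∀ v : EuclideanSpace ℝ (Fin m), ∀ t ∈ Icc a b,
      ‖f x₁ v t - f x₂ v t‖ ≤ M * ‖x₁ - x₂‖)
    (u ub : ℝ → EuclideanSpace ℝ (Fin m))
    (hu : ContinuousOn u (Icc a b)) (hub : ContinuousOn ub (Icc a b))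
    (Q : ℝ → ℝ → EuclideanSpace ℝ (Fin d))
    (hQc : ∀ ε : ℝ, ContinuousOn (Q ε) (Icc a b))
    (hQ : ∀ ε : ℝ, ∀ t ∈ Icc a b,
      Q ε t = A + Ileft a α (fun s => f (Q ε s) (u s + ε • ub s) s) t) :
    ∃ C₁ : ℝ, 0 ≤ C₁ ∧ ∀ ε : ℝ, |ε| < 1 → ∀ t ∈ Icc a b,
      ‖Q ε t - Q 0 t‖ ≤ C₁ * |ε| := by
  have hfc := hf.continuousOn
  have hgc : ∀ ε : ℝ, ContinuousOn (fun s => f (Q ε s) (u s + ε • ub s) s) (Icc a b) := fun ε =>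
    hfc.comp ((hQc ε).prodMk ((hu.add (hub.const_smul ε)).prodMk continuousOn_id))
      fun s hs => ⟨mem_univ _, mem_univ _, hs⟩
  obtain ⟨RQ, hRQ⟩ := isCompact_Icc.exists_bound_of_continuousOn (hQc 0)
  obtain ⟨Ru, hRu⟩ := isCompact_Icc.exists_bound_of_continuousOn hu
  obtain ⟨Rb, hRb⟩ := isCompact_Icc.exists_bound_of_continuousOn hub
  have hRb0 : 0 ≤ Rb := (norm_nonneg _).trans (hRb a (left_mem_Icc.2 hab.le))
  obtain ⟨K, hK⟩ := (hf.mono (s := univ ×ˢ univ ×ˢ Icc a b)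
      (t := Metric.closedBall 0 RQ ×ˢ Metric.closedBall 0 (Ru + Rb) ×ˢ Icc a b)
      (prod_mono (subset_univ _) (prod_mono (subset_univ _) Subset.rfl))
    ).exists_lipschitzOnWith_of_isCompact
      ((isCompact_closedBall _ _).prod ((isCompact_closedBall _ _).prod isCompact_Icc))
      ((convex_closedBall _ _).prod ((convex_closedBall _ _).prod (convex_Icc a b)))
  set l : ℝ := (M + 1) ^ α⁻¹ with hl_def
  have hl : 0 < l := Real.rpow_pos_of_pos (by linarith) _
  have hlM : l ^ α = M + 1 := Real.rpow_inv_rpow (by linarith) hα0.ne'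
  refine ⟨K * Rb * Real.exp (l * (b - a)), by positivity, fun ε hε t ht => ?_⟩
  have hcontrol : ∀ s ∈ Icc a b,
      ‖f (Q 0 s) (u s + ε • ub s) s - f (Q 0 s) (u s + (0 : ℝ) • ub s) s‖ ≤ K * Rb * |ε| := by
    intro s hs
    have hball : ∀ c : ℝ, |c| < 1 → u s + c • ub s ∈ Metric.closedBall 0 (Ru + Rb) := by
      intro c hc
      rw [mem_closedBall_zero_iff]
      refine (norm_add_le _ _).trans (add_le_add (hRu s hs) ?_)
      rw [norm_smul, Real.norm_eq_abs]
      exact (mul_le_of_le_one_left (norm_nonneg _) hc.le).trans (hRb s hs)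
    have hQs : Q 0 s ∈ Metric.closedBall 0 RQ := mem_closedBall_zero_iff.2 (hRQ s hs)
    have h := hK.norm_sub_le (x := (Q 0 s, u s + ε • ub s, s))
      (y := (Q 0 s, u s + (0 : ℝ) • ub s, s))
      ⟨hQs, hball ε hε, hs⟩ ⟨hQs, hball 0 (by simp), hs⟩
    refine h.trans ?_
    have hnorm : ‖((Q 0 s, u s + ε • ub s, s) : EuclideanSpace ℝ (Fin d) ×
        EuclideanSpace ℝ (Fin m) × ℝ) - (Q 0 s, u s + (0 : ℝ) • ub s, s)‖ = |ε| * ‖ub s‖ := by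
      simp [Prod.norm_def, norm_smul]
      positivity
    rw [hnorm, mul_assoc, mul_comm Rb]
    gcongr
    exact hRb s hs
  have hdiff : ∀ s ∈ Icc a b,
      ‖f (Q ε s) (u s + ε • ub s) s - f (Q 0 s) (u s + (0 : ℝ) • ub s) s‖
        ≤ M * ‖Q ε s - Q 0 s‖ + K * Rb * |ε| := fun s hs =>
    (norm_sub_le_norm_sub_add_norm_sub _ _ _).trans
      (add_le_add (hlip _ _ _ s hs) (hcontrol s hs))
  have hec : ContinuousOn (fun s => ‖Q ε s - Q 0 s‖) (Icc a b) := ((hQc ε).sub (hQc 0)).norm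
  have hgron := le_mul_exp_of_le_Ileft hα0 hM (δ := K * Rb * |ε|) (by positivity) hl hlM hec
    (fun _ _ => norm_nonneg _) (fun s hs => by
      have hsub : Icc a s ⊆ Icc a b := Icc_subset_Icc_right hs.2
      rw [hQ ε s hs, hQ 0 s hs, add_sub_add_left_eq_sub]
      exact norm_Ileft_sub_le_s12 hα0 hs.1 ((hgc ε).mono hsub) ((hgc 0).mono hsub)
        ((continuousOn_const.mul (hec.mono hsub)).add continuousOn_const)
        fun y hy => hdiff y (hsub hy)) t ht
  calc ‖Q ε t - Q 0 t‖ ≤ K * Rb * |ε| * Real.exp (l * (t - a)) := hgron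
    _ ≤ K * Rb * |ε| * Real.exp (l * (b - a)) := by
        gcongr
        exact ht.2
    _ = K * Rb * Real.exp (l * (b - a)) * |ε| := by ring
end
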